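/- arXiv:2502.18164 — 3 statements merged into one kernel-verified Lean document; each statement's English description precedes it below -/
import Mathlib

section
/- Let σ ≤ τ, let X : [σ,τ] → ℝ^d be a characteristic curve of u, and suppose the differentiable function ρ solves the continuity equation at every point (t, X(t)) with t ∈ [σ,τ], and that t ↦ (div_x u)(t, X(t)) is continuous on [σ,τ]. Then ρ(τ, X(τ)) = ρ(σ, X(σ)) · exp( − ∫_σ^τ (div_x u)(t, X(t)) dt ). -/
open MeasureTheory Set Filter

/-- The spatial divergence of a time-dependent velocity field
`u : ℝ × ℝ^d → ℝ^d`: `(div_x u)(t,x) = ∑ i, ∂uᵢ/∂xᵢ(t,x)`. -/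
noncomputable def spatialDiv (d : ℕ) (u : ℝ × (Fin d → ℝ) → (Fin d → ℝ))
    (t : ℝ) (x : Fin d → ℝ) : ℝ :=
  ∑ i : Fin d, fderiv ℝ (fun y => u (t, y) i) x (Pi.single i 1)

/-- `ρ` solves the continuity equation at `(t,x)`:
`∂ₜρ(t,x) + u(t,x)·∇ₓρ(t,x) + ρ(t,x)·(div_x u)(t,x) = 0`. -/
noncomputable def SolvesContinuityAt (d : ℕ) (u : ℝ × (Fin d → ℝ) → (Fin d → ℝ))
    (ρ : ℝ × (Fin d → ℝ) → ℝ) (t : ℝ) (x : Fin d → ℝ) : Prop :=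
  fderiv ℝ ρ (t, x) ((1 : ℝ), (0 : Fin d → ℝ))
    + fderiv ℝ ρ (t, x) ((0 : ℝ), u (t, x))
    + ρ (t, x) * spatialDiv d u t x = 0

/-- A solution of the linear scalar equation `f' = -f a` on `[σ, τ]`, with `a` continuous there,
is given by the exponential of the integral of `-a`. -/
theorem eq_mul_exp_neg_integral_of_hasDerivWithinAt {f a : ℝ → ℝ} {σ τ : ℝ} (hστ : σ ≤ τ)
    (hf : ContinuousOn f (Set.Icc σ τ))
    (hf' : ∀ t ∈ Set.Ico σ τ, HasDerivWithinAt f (-(f t * a t)) (Set.Ici t) t)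
    (ha : ContinuousOn a (Set.Icc σ τ)) :
    f τ = f σ * Real.exp (-(∫ t in σ..τ, a t)) := by
  set A : ℝ → ℝ := Set.IccExtend hστ ((Set.Icc σ τ).domRestrict a) with hA
  have hAcont : Continuous A := ha.domRestrict.Icc_extend'
  have hAa : ∀ t ∈ Set.Icc σ τ, A t = a t := fun t ht => by
    rw [hA, Set.IccExtend_of_mem hστ _ ht, Set.domRestrict_apply]
  have hint : ∫ t in σ..τ, a t = ∫ t in σ..τ, A t := by
    refine intervalIntegral.integral_congr fun t ht => ?_
    rw [Set.uIcc_of_le hστ] at ht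
    exact (hAa t ht).symm
  have hI : ∀ t, HasDerivAt (fun s => ∫ r in σ..s, A r) (A t) t := fun t =>
    hAcont.integral_hasStrictDerivAt σ t |>.hasDerivAt
  have hconst := constant_of_has_deriv_right_zero
    (f := fun t => f t * Real.exp (∫ r in σ..t, A r)) (a := σ) (b := τ)
    (hf.mul fun t _ => (hI t).exp.continuousAt.continuousWithinAt)
    (fun t ht => by
      refine ((hf' t ht).mul (hI t).exp.hasDerivWithinAt).congr_deriv ?_
      rw [hAa t (Set.Ico_subset_Icc_self ht)]
      ring)
    τ (Set.right_mem_Icc.2 hστ)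
  simp only [intervalIntegral.integral_same, Real.exp_zero, mul_one] at hconst
  rw [hint, ← hconst, mul_assoc, ← Real.exp_add, add_neg_cancel, Real.exp_zero, mul_one]

/-- The derivative of a solution of the continuity equation along a characteristic. -/
theorem SolvesContinuityAt.hasDerivAt_comp {d : ℕ} {u : ℝ × (Fin d → ℝ) → (Fin d → ℝ)}
    {ρ : ℝ × (Fin d → ℝ) → ℝ} {X : ℝ → (Fin d → ℝ)} {t : ℝ}
    (h : SolvesContinuityAt d u ρ t (X t)) (hρ : DifferentiableAt ℝ ρ (t, X t))
    (hX : HasDerivAt X (u (t, X t)) t) :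
    HasDerivAt (fun s => ρ (s, X s)) (-(ρ (t, X t) * spatialDiv d u t (X t))) t := by
  have hcurve : HasDerivAt (fun s => (s, X s)) ((1 : ℝ), u (t, X t)) t :=
    (hasDerivAt_id t).prodMk hX
  refine (hρ.hasFDerivAt.comp_hasDerivAt t hcurve).congr_deriv ?_
  have hsplit : ((1 : ℝ), u (t, X t)) = ((1 : ℝ), (0 : Fin d → ℝ)) + ((0 : ℝ), u (t, X t)) := by
    simp
  rw [hsplit, map_add]
  exact eq_neg_of_add_eq_zero_left h

/-- integrating the continuity equation along a characteristic:
`ρ(τ, X τ) = ρ(σ, X σ) · exp(−∫_σ^τ (div_x u)(t, X t) dt)`. -/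
theorem density_formula_along_characteristic
    (d : ℕ) (hd : 1 ≤ d)
    (u : ℝ × (Fin d → ℝ) → (Fin d → ℝ))
    (hu : ∀ (t : ℝ) (x : Fin d → ℝ), DifferentiableAt ℝ (fun y => u (t, y)) x)
    (ρ : ℝ × (Fin d → ℝ) → ℝ) (hρ : Differentiable ℝ ρ)
    (σ τ : ℝ) (hστ : σ ≤ τ) (X : ℝ → (Fin d → ℝ))
    (hX : ∀ t ∈ Set.Icc σ τ, HasDerivAt X (u (t, X t)) t)
    (hce : ∀ t ∈ Set.Icc σ τ, SolvesContinuityAt d u ρ t (X t))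
    (hcont : ContinuousOn (fun t => spatialDiv d u t (X t)) (Set.Icc σ τ)) :
    ρ (τ, X τ) = ρ (σ, X σ) * Real.exp (-(∫ t in σ..τ, spatialDiv d u t (X t))) := by
  have hderiv : ∀ t ∈ Set.Icc σ τ, HasDerivAt (fun s => ρ (s, X s))
      (-(ρ (t, X t) * spatialDiv d u t (X t))) t := fun t ht =>
    (hce t ht).hasDerivAt_comp (hρ _) (hX t ht)
  exact eq_mul_exp_neg_integral_of_hasDerivWithinAt (f := fun s => ρ (s, X s)) hστ
    (fun t ht => (hderiv t ht).continuousAt.continuousWithinAt)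
    (fun t ht => (hderiv t (Set.Ico_subset_Icc_self ht)).hasDerivWithinAt) hcont
end

section
/- (Maximum principle for the density along characteristics.) Let σ ≤ τ, let X : [σ,τ] → ℝ^d be a characteristic curve of u, suppose the differentiable function ρ solves the continuity equation at every point (t, X(t)) with t ∈ [σ,τ], that t ↦ (div_x u)(t, X(t)) is continuous on [σ,τ], and that there is a continuous function D : [σ,τ] → ℝ with |(div_x u)(t,x)| ≤ D(t) for all t ∈ [σ,τ] and all x ∈ ℝ^d. If 0 ≤ ρ(σ, X(σ)) ≤ M, then ρ(τ, X(τ)) ≤ M · exp( ∫_σ^τ D(t) dt ). -/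
open MeasureTheory Set Filter

/-- A solution of the scalar linear equation `f' = -g f` on `[a, b]` with `g` continuous is given by
the exponential formula. -/
theorem eq_mul_exp_neg_integral_of_hasDerivAt {f g : ℝ → ℝ} {a b : ℝ} (hab : a ≤ b)
    (hg : ContinuousOn g (Set.Icc a b))
    (hf : ∀ t ∈ Set.Icc a b, HasDerivAt f (-(f t * g t)) t) :
    f b = f a * Real.exp (-∫ t in a..b, g t) := by
  let G : ℝ → ℝ := Set.IccExtend hab ((Set.Icc a b).domRestrict g)
  have hG : Continuous G := hg.domRestrict.Icc_extend'
  have hGg : ∀ t ∈ Set.Icc a b, G t = g t := fun t ht =>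
    Set.IccExtend_of_mem hab _ ht
  have hint : ∫ t in a..b, G t = ∫ t in a..b, g t :=
    intervalIntegral.integral_congr fun t ht => hGg t (by rwa [Set.uIcc_of_le hab] at ht)
  have hderiv : ∀ t ∈ Set.Icc a b,
      HasDerivAt (fun t => f t * Real.exp (∫ s in a..t, G s)) 0 t := fun t ht => by
    refine ((hf t ht).mul (hG.integral_hasStrictDerivAt a t).hasDerivAt.exp).congr_deriv ?_
    rw [hGg t ht]
    ring
  have hconst := constant_of_has_deriv_right_zero
    (fun t ht => (hderiv t ht).continuousAt.continuousWithinAt)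
    (fun t ht => (hderiv t (Set.Ico_subset_Icc_self ht)).hasDerivWithinAt)
    b (Set.right_mem_Icc.2 hab)
  simp only [intervalIntegral.integral_same, Real.exp_zero, mul_one, hint] at hconst
  rw [← hconst, mul_assoc, ← Real.exp_add, add_neg_cancel, Real.exp_zero, mul_one]

/-- Along a characteristic, a solution of the continuity equation satisfies
`d/dt ρ(t, X t) = -ρ(t, X t) (div_x u)(t, X t)`. -/
theorem SolvesContinuityAt.hasDerivAt_along_characteristic {d : ℕ}
    {u : ℝ × (Fin d → ℝ) → (Fin d → ℝ)} {ρ : ℝ × (Fin d → ℝ) → ℝ} {X : ℝ → (Fin d → ℝ)} {t : ℝ}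
    (hce : SolvesContinuityAt d u ρ t (X t)) (hρ : DifferentiableAt ℝ ρ (t, X t))
    (hX : HasDerivAt X (u (t, X t)) t) :
    HasDerivAt (fun s => ρ (s, X s)) (-(ρ (t, X t) * spatialDiv d u t (X t))) t := by
  have h := hρ.hasFDerivAt.comp_hasDerivAt t ((hasDerivAt_id t).prodMk hX)
  have hsplit : ((1 : ℝ), u (t, X t)) = (1, 0) + (0, u (t, X t)) := by simp
  rw [hsplit, map_add, eq_neg_of_add_eq_zero_left hce] at h
  exact h

/-- Maximum principle for the density along characteristics:
if `0 ≤ ρ(σ, X σ) ≤ M` and `|div_x u| ≤ D` on `[σ,τ] × ℝ^d`, then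
`ρ(τ, X τ) ≤ M · exp(∫_σ^τ D)`. -/
theorem density_maximum_principle_along_characteristic
    (d : ℕ) (hd : 1 ≤ d)
    (u : ℝ × (Fin d → ℝ) → (Fin d → ℝ))
    (hu : ∀ (t : ℝ) (x : Fin d → ℝ), DifferentiableAt ℝ (fun y => u (t, y)) x)
    (ρ : ℝ × (Fin d → ℝ) → ℝ) (hρ : Differentiable ℝ ρ)
    (σ τ : ℝ) (hστ : σ ≤ τ) (X : ℝ → (Fin d → ℝ))
    (hX : ∀ t ∈ Set.Icc σ τ, HasDerivAt X (u (t, X t)) t)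
    (hce : ∀ t ∈ Set.Icc σ τ, SolvesContinuityAt d u ρ t (X t))
    (hcont : ContinuousOn (fun t => spatialDiv d u t (X t)) (Set.Icc σ τ))
    (D : ℝ → ℝ) (hD : ContinuousOn D (Set.Icc σ τ))
    (hbound : ∀ t ∈ Set.Icc σ τ, ∀ x : Fin d → ℝ, |spatialDiv d u t x| ≤ D t)
    (M : ℝ) (hσ0 : 0 ≤ ρ (σ, X σ)) (hσM : ρ (σ, X σ) ≤ M) :
    ρ (τ, X τ) ≤ M * Real.exp (∫ t in σ..τ, D t) := by
  rw [eq_mul_exp_neg_integral_of_hasDerivAt (f := fun t => ρ (t, X t)) hστ hcont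
    fun t ht => (hce t ht).hasDerivAt_along_characteristic (hρ _) (hX t ht),
    ← intervalIntegral.integral_neg]
  gcongr
  · exact hσ0.trans hσM
  · refine intervalIntegral.integral_mono_on hστ ?_ ?_ fun t ht =>
      (neg_le_abs _).trans (hbound t ht (X t))
    · exact hcont.neg.intervalIntegrable_of_Icc hστ
    · exact hD.intervalIntegrable_of_Icc hστ
end

section
/- (p-th power Gronwall step.) Let T > 0, let p ∈ [1,∞), let a, k : [0,T] → ℝ be continuous with a(t) ≥ 0 and k(t) ≥ 0 for all t, and let y : [0,T] → ℝ be continuous on [0,T], strictly positive, and differentiable on (0,T), and suppose that for all t ∈ (0,T) the derivative of t ↦ y(t)^p satisfies (y^p)'(t) ≤ p·( a(t) y(t)^p + k(t) y(t)^{p−1} ). Then y(T) ≤ ( y(0) + ∫_0^T k(t) dt ) · exp( ∫_0^T a(t) dt ). -/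
open MeasureTheory Set intervalIntegral

/-- The fundamental theorem of calculus in the interior of an interval on which the integrand is
continuous. -/
theorem hasDerivAt_integral_of_continuousOn_Icc {f : ℝ → ℝ} {b c t : ℝ}
    (hf : ContinuousOn f (Icc b c)) (ht : t ∈ Ioo b c) :
    HasDerivAt (fun s => ∫ x in b..s, f x) (f t) t := by
  refine integral_hasDerivAt_right ?_ ?_ (hf.continuousAt (Icc_mem_nhds ht.1 ht.2))
  · refine ContinuousOn.intervalIntegrable ?_
    rw [uIcc_of_le ht.1.le]
    exact hf.mono (Icc_subset_Icc_right ht.2.le)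
  · exact (hf.mono Ioo_subset_Icc_self).stronglyMeasurableAtFilter isOpen_Ioo t ht

/-- The primitive of a function continuous on a compact interval is continuous there. -/
theorem continuousOn_integral_of_continuousOn_Icc {f : ℝ → ℝ} {b c : ℝ} (hbc : b ≤ c)
    (hf : ContinuousOn f (Icc b c)) :
    ContinuousOn (fun s => ∫ x in b..s, f x) (Icc b c) := by
  have h := continuousOn_primitive_interval (μ := volume) (f := f) (a := b) (b := c)
  rw [uIcc_of_le hbc] at h
  exact h (hf.integrableOn_compact isCompact_Icc)

/-- Gronwall's inequality for `y' ≤ a y + k` with nonnegative continuous coefficients. -/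
theorem le_add_integral_mul_exp_of_deriv_le {T : ℝ} (hT : 0 ≤ T) {a k y y' : ℝ → ℝ}
    (ha : ContinuousOn a (Icc 0 T)) (hk : ContinuousOn k (Icc 0 T))
    (ha0 : ∀ t ∈ Icc (0 : ℝ) T, 0 ≤ a t) (hk0 : ∀ t ∈ Icc (0 : ℝ) T, 0 ≤ k t)
    (hy : ContinuousOn y (Icc 0 T)) (hy' : ∀ t ∈ Ioo (0 : ℝ) T, HasDerivAt y (y' t) t)
    (hle : ∀ t ∈ Ioo (0 : ℝ) T, y' t ≤ a t * y t + k t) :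
    y T ≤ (y 0 + ∫ t in (0 : ℝ)..T, k t) * Real.exp (∫ t in (0 : ℝ)..T, a t) := by
  set A : ℝ → ℝ := fun s => ∫ t in (0 : ℝ)..s, a t with hA
  set K : ℝ → ℝ := fun s => ∫ t in (0 : ℝ)..s, k t with hK
  have hanti : AntitoneOn (fun s => y s * Real.exp (-A s) - K s) (Icc 0 T) := by
    have hderiv : ∀ t ∈ Ioo (0 : ℝ) T, HasDerivAt (fun s => y s * Real.exp (-A s) - K s)
        (y' t * Real.exp (-A t) + y t * (Real.exp (-A t) * -a t) - k t) t := fun t ht =>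
      ((hy' t ht).mul (hasDerivAt_integral_of_continuousOn_Icc ha ht).neg.exp).sub
        (hasDerivAt_integral_of_continuousOn_Icc hk ht)
    refine antitoneOn_of_deriv_nonpos (convex_Icc 0 T) ?_ ?_ ?_
    · exact (hy.mul (continuousOn_integral_of_continuousOn_Icc hT ha).neg.rexp).sub
        (continuousOn_integral_of_continuousOn_Icc hT hk)
    · rw [interior_Icc]
      exact fun t ht => (hderiv t ht).differentiableAt.differentiableWithinAt
    · rw [interior_Icc]
      intro t ht
      rw [(hderiv t ht).deriv]
      have hAt : 0 ≤ A t := integral_nonneg ht.1.le fun s hs => ha0 s ⟨hs.1, hs.2.trans ht.2.le⟩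
      have hexp : Real.exp (-A t) ≤ 1 := Real.exp_le_one_iff.2 (neg_nonpos.2 hAt)
      have hgrow := mul_le_mul_of_nonneg_right (hle t ht) (Real.exp_pos (-A t)).le
      have hforce := mul_le_mul_of_nonneg_left hexp (hk0 t (Ioo_subset_Icc_self ht))
      linarith
  have hend := hanti (left_mem_Icc.2 hT) (right_mem_Icc.2 hT) hT
  simp only [hA, hK, integral_same, neg_zero, Real.exp_zero, mul_one, sub_zero] at hend
  rw [Real.exp_neg, sub_le_iff_le_add, ← div_eq_mul_inv, div_le_iff₀ (Real.exp_pos _)] at hend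
  exact hend

/-- p-th power Gronwall step: if `y > 0` is continuous on `[0,T]`,
differentiable on `(0,T)`, and the derivative of `t ↦ y(t)^p` satisfies
`(y^p)'(t) ≤ p(a(t) y(t)^p + k(t) y(t)^{p−1})` on `(0,T)` with `a, k ≥ 0`
continuous on `[0,T]`, then `y(T) ≤ (y(0) + ∫₀ᵀ k) · exp(∫₀ᵀ a)`. -/
theorem pth_power_gronwall_step
    (T p : ℝ) (hT : 0 < T) (hp : 1 ≤ p) (a k y z : ℝ → ℝ)
    (ha : ContinuousOn a (Set.Icc 0 T)) (hk : ContinuousOn k (Set.Icc 0 T))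
    (ha0 : ∀ t ∈ Set.Icc (0:ℝ) T, 0 ≤ a t)
    (hk0 : ∀ t ∈ Set.Icc (0:ℝ) T, 0 ≤ k t)
    (hy : ContinuousOn y (Set.Icc 0 T))
    (hypos : ∀ t ∈ Set.Icc (0:ℝ) T, 0 < y t)
    (hydiff : ∀ t ∈ Set.Ioo (0:ℝ) T, DifferentiableAt ℝ y t)
    (hz : ∀ t ∈ Set.Ioo (0:ℝ) T, HasDerivAt (fun s => y s ^ p) (z t) t)
    (hineq : ∀ t ∈ Set.Ioo (0:ℝ) T,
      z t ≤ p * (a t * y t ^ p + k t * y t ^ (p - 1))) :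
    y T ≤ (y 0 + ∫ t in (0:ℝ)..T, k t) * Real.exp (∫ t in (0:ℝ)..T, a t) := by
  refine le_add_integral_mul_exp_of_deriv_le hT.le ha hk ha0 hk0 hy
    (fun t ht => (hydiff t ht).hasDerivAt) fun t ht => ?_
  have hyt := hypos t (Ioo_subset_Icc_self ht)
  have hzt : z t = deriv y t * p * y t ^ (p - 1) :=
    (hz t ht).unique ((hydiff t ht).hasDerivAt.rpow_const (Or.inl hyt.ne'))
  have hpow : y t ^ p = y t * y t ^ (p - 1) := by
    rw [Real.rpow_sub_one hyt.ne', mul_div_cancel₀ _ hyt.ne']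
  have hle := hineq t ht
  rw [hzt, hpow] at hle
  have hpos : 0 < p * y t ^ (p - 1) :=
    mul_pos (zero_lt_one.trans_le hp) (Real.rpow_pos_of_pos hyt _)
  refine le_of_mul_le_mul_right ?_ hpos
  linarith
end
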